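/- Let R = End_K(U) be the endomorphism ring of an n-dimensional left vector space U over a (not necessarily commutative) field K, 1 ≤ n < ∞, let 𝔐 = (𝒢, ℒ) be the associated Grassmann space, and let Ψ: ℙ(R) → 𝒢 be the bijection R(a,b) ↦ U^{(a,b)}. Then for all p, q, r ∈ ℙ(R): (1) p ∼ q ⇔ Ψ(p) and Ψ(q) are adjacent elements of 𝒢 ⇔ Ψ(p) and Ψ(q) are distinct collinear points of 𝔐; (2) p ∼ q via r ⇔ Ψ(p), Ψ(q), Ψ(r) are three distinct collinear points of 𝔐. -/

import Mathlib

/-- `p` is a point of the projective line over `R`. -/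
def IsPoint (R : Type*) [Ring R] (p : Submodule R (R × R)) : Prop :=
  ∃ g : (Matrix (Fin 2) (Fin 2) R)ˣ,
    p = Submodule.span R {(g.val 0 0, g.val 0 1)}

/-- distant relation -/
def Distant {R : Type*} [Ring R] (p q : Submodule R (R × R)) : Prop :=
  ∃ g : (Matrix (Fin 2) (Fin 2) R)ˣ,
    p = Submodule.span R {(g.val 0 0, g.val 0 1)} ∧
    q = Submodule.span R {(g.val 1 0, g.val 1 1)}

def DistantSet {R : Type*} [Ring R] (p : Submodule R (R × R)) :
    Set (Submodule R (R × R)) := {x | Distant x p}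

def Parallel {R : Type*} [Ring R] (p q : Submodule R (R × R)) : Prop :=
  DistantSet p ⊆ DistantSet q

def AdjacentVia {R : Type*} [Ring R] (p q r : Submodule R (R × R)) : Prop :=
  ¬ Parallel r p ∧ ¬ Parallel r q ∧ DistantSet r ⊆ DistantSet p ∪ DistantSet q

def Adjacent {R : Type*} [Ring R] (p q : Submodule R (R × R)) : Prop :=
  ∃ r, IsPoint R r ∧ AdjacentVia p q r

/-- The (opposite of the) endomorphism ring of `U`, i.e. `End_K(U)` with endomorphisms
written on the right, as in the paper. -/
abbrev EndOp (K U : Type*) [DivisionRing K] [AddCommGroup U] [Module K U] :=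
  (Module.End K U)ᵐᵒᵖ

/-- `L` is a line (pencil) of the Grassmann space of `n`-dimensional subspaces of `V`. -/
def IsPencilLine (K : Type*) {V : Type*} [DivisionRing K] [AddCommGroup V] [Module K V]
    (n : ℕ) (L : Set (Submodule K V)) : Prop :=
  ∃ M N : Submodule K V, Module.finrank K M = n - 1 ∧ Module.finrank K N = n + 1 ∧
    M < N ∧ L = {X | M < X ∧ X < N}

section GrassmannSpace

open Module Submodule

variable {K V : Type*} [DivisionRing K] [AddCommGroup V] [Module K V]

/-- The relation on subspaces which corresponds to `AdjacentVia` on points. -/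
def ComplAdjacentVia (P Q R : Submodule K V) : Prop :=
  (¬ ∀ X, IsCompl X R → IsCompl X P) ∧ (¬ ∀ X, IsCompl X R → IsCompl X Q) ∧
    ∀ X, IsCompl X R → IsCompl X P ∨ IsCompl X Q

/-- Complements of `R` are complements of `P` only if `P ≤ R`. -/
theorem Submodule.le_of_forall_isCompl {P R : Submodule K V}
    (h : ∀ X, IsCompl X R → IsCompl X P) : P ≤ R := by
  intro v hv
  by_contra hvR
  have hd : Disjoint (span K {v}) R := by
    rw [disjoint_comm, disjoint_span_singleton' (by rintro rfl; simp at hvR)]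
    exact hvR
  obtain ⟨X, hX, hXR⟩ := hd.exists_isCompl
  have := disjoint_def.1 (h X hXR).disjoint v (hX (mem_span_singleton_self v)) hv
  simp [this] at hvR

variable [FiniteDimensional K V]

theorem Submodule.exists_sub_smul_mem_of_finrank_eq_succ {A B : Submodule K V} (hAB : A ≤ B)
    (h : finrank K B = finrank K A + 1) {x y : V} (hx : x ∈ B) (hxA : x ∉ A) (hy : y ∈ B) :
    ∃ c : K, y - c • x ∈ A := by
  have hsup : A ⊔ span K {x} = B := by
    apply eq_of_le_of_finrank_le
    · exact sup_le hAB (by simpa using hx)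
    · rw [finrank_sup_span_singleton hxA, h]
  rw [← hsup] at hy
  obtain ⟨a, ha, z, hz, rfl⟩ := mem_sup.1 hy
  obtain ⟨c, rfl⟩ := mem_span_singleton.1 hz
  exact ⟨c, by simpa using ha⟩

theorem Submodule.isCompl_of_forall_eq_zero {n : ℕ} {X P R : Submodule K V} (hXR : IsCompl X R)
    (hP : finrank K P = n) (hR : finrank K R = n) (h : ∀ x ∈ X, x ∈ P → x = 0) :
    IsCompl X P := by
  rw [isCompl_iff_disjoint _ _ (by rw [hP, ← hR, finrank_add_eq_of_isCompl hXR])]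
  exact disjoint_def.2 h

theorem Submodule.finrank_eq_of_lt_of_lt {n : ℕ} (hn : 1 ≤ n) {M N X : Submodule K V}
    (hM : finrank K M = n - 1) (hN : finrank K N = n + 1) (hMX : M < X) (hXN : X < N) :
    finrank K X = n := by
  have := finrank_lt_finrank_of_lt hMX
  have := finrank_lt_finrank_of_lt hXN
  omega

theorem Submodule.inf_eq_of_finrank_eq {n : ℕ} {M P Q : Submodule K V}
    (hM : finrank K M = n - 1) (hP : finrank K P = n) (hQ : finrank K Q = n)
    (hMP : M ≤ P) (hMQ : M ≤ Q) (hPQ : P ≠ Q) : M = P ⊓ Q := by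
  refine eq_of_le_of_finrank_le (le_inf hMP hMQ) ?_
  have : P ⊓ Q < P := inf_lt_left.2 fun h => hPQ (eq_of_le_of_finrank_le h (by omega))
  have := finrank_lt_finrank_of_lt this
  omega

theorem ComplAdjacentVia.of_isPencilLine {n : ℕ} (hn : 1 ≤ n) {P Q R : Submodule K V}
    (hPQ : P ≠ Q) (hPR : P ≠ R) (hQR : Q ≠ R) {L : Set (Submodule K V)}
    (hL : IsPencilLine K n L) (hPL : P ∈ L) (hQL : Q ∈ L) (hRL : R ∈ L) :
    ComplAdjacentVia P Q R := by
  obtain ⟨M, N, hM, hN, -, rfl⟩ := hL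
  have hP := finrank_eq_of_lt_of_lt hn hM hN hPL.1 hPL.2
  have hQ := finrank_eq_of_lt_of_lt hn hM hN hQL.1 hQL.2
  have hR := finrank_eq_of_lt_of_lt hn hM hN hRL.1 hRL.2
  refine ⟨fun h => hPR ?_, fun h => hQR ?_, fun X hX => ?_⟩
  · exact eq_of_le_of_finrank_le (le_of_forall_isCompl h) (by omega)
  · exact eq_of_le_of_finrank_le (le_of_forall_isCompl h) (by omega)
  · by_contra! hcon
    obtain ⟨h1, h2⟩ := hcon
    have hxP : ¬ ∀ x ∈ X, x ∈ P → x = 0 := fun h => h1 (isCompl_of_forall_eq_zero hX hP hR h)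
    have hxQ : ¬ ∀ x ∈ X, x ∈ Q → x = 0 := fun h => h2 (isCompl_of_forall_eq_zero hX hQ hR h)
    push Not at hxP hxQ
    obtain ⟨x, hxX, hxP, hx0⟩ := hxP
    obtain ⟨y, hyX, hyQ, hy0⟩ := hxQ
    have hd := disjoint_def.1 hX.disjoint
    have hxR : x ∉ R := fun h => hx0 (hd x hxX h)
    obtain ⟨c, hc⟩ := exists_sub_smul_mem_of_finrank_eq_succ hRL.2.le (by omega)
      (hPL.2.le hxP) hxR (hQL.2.le hyQ)
    have hyx : y = c • x := sub_eq_zero.1 (hd _ (X.sub_mem hyX (X.smul_mem c hxX)) hc)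
    have hyM : y ∈ M := by
      rw [inf_eq_of_finrank_eq hM hP hQ hPL.1.le hQL.1.le hPQ]
      exact ⟨hyx ▸ P.smul_mem c hxP, hyQ⟩
    exact hy0 (hd y hyX (hRL.1.le hyM))

theorem ComplAdjacentVia.exists_isPencilLine {n : ℕ} (hn : 1 ≤ n) {P Q R : Submodule K V}
    (hP : finrank K P = n) (hQ : finrank K Q = n) (hR : finrank K R = n)
    (h : ComplAdjacentVia P Q R) :
    P ≠ Q ∧ P ≠ R ∧ Q ≠ R ∧ ∃ L, IsPencilLine K n L ∧ P ∈ L ∧ Q ∈ L ∧ R ∈ L := by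
  obtain ⟨h1, h2, h3⟩ := h
  have hPR : P ≠ R := by rintro rfl; exact h1 fun _ => id
  have hQR : Q ≠ R := by rintro rfl; exact h2 fun _ => id
  have key : ∀ v ∈ P, v ∉ R → ∀ w ∈ Q, w ∉ R → ¬ Disjoint (span K {v, w}) R := by
    intro v hv hvR w hw hwR hd
    obtain ⟨X, hX, hXR⟩ := hd.exists_isCompl
    rcases h3 X hXR with h | h
    · have := disjoint_def.1 h.disjoint v (hX (subset_span (by simp))) hv
      simp [this] at hvR
    · have := disjoint_def.1 h.disjoint w (hX (subset_span (by simp))) hw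
      simp [this] at hwR
  have hdep : ∀ v w, v ∉ R → ¬ Disjoint (span K {v, w}) R → ∃ c : K, w - c • v ∈ R := by
    intro v w hvR hd
    rw [disjoint_def] at hd
    push Not at hd
    obtain ⟨z, hz, hzR, hz0⟩ := hd
    obtain ⟨a, b, rfl⟩ := mem_span_pair.1 hz
    by_cases hb : b = 0
    · subst hb
      have ha : a ≠ 0 := by rintro rfl; simp at hz0
      rw [zero_smul, add_zero, R.smul_mem_iff ha] at hzR
      exact absurd hzR hvR
    · refine ⟨-(b⁻¹ * a), ?_⟩
      have := R.smul_mem b⁻¹ hzR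
      rw [smul_add, smul_smul, smul_smul, inv_mul_cancel₀ hb, one_smul] at this
      rwa [neg_smul, sub_neg_eq_add, add_comm]
  have hinf : P ⊓ Q ≤ R := by
    rintro v ⟨hvP, hvQ⟩
    by_contra hvR
    refine key v hvP hvR v hvQ hvR ?_
    rw [Set.pair_eq_singleton, disjoint_comm, disjoint_span_singleton' (by rintro rfl; simp at hvR)]
    exact hvR
  obtain ⟨v, hvP, hvR⟩ : ∃ v ∈ P, v ∉ R := SetLike.not_le_iff_exists.1
    fun h => hPR (eq_of_le_of_finrank_le h (by omega))
  obtain ⟨w, hwQ, hwR⟩ : ∃ w ∈ Q, w ∉ R := SetLike.not_le_iff_exists.1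
    fun h => hQR (eq_of_le_of_finrank_le h (by omega))
  have hmem : ∀ {x y : V} {c : K}, y - c • x ∈ R → x ∈ R ⊔ span K {v} →
      y ∈ R ⊔ span K {v} := by
    intro x y c hc hx
    rw [← sub_add_cancel y (c • x)]
    exact add_mem (mem_sup_left hc) (smul_mem _ c hx)
  have hvN : v ∈ R ⊔ span K {v} := mem_sup_right (mem_span_singleton_self v)
  have hQN : Q ≤ R ⊔ span K {v} := by
    intro y hy
    by_cases hyR : y ∈ R
    · exact mem_sup_left hyR
    · obtain ⟨c, hc⟩ := hdep v y hvR (key v hvP hvR y hy hyR)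
      exact hmem hc hvN
  have hPN : P ≤ R ⊔ span K {v} := by
    intro x hx
    by_cases hxR : x ∈ R
    · exact mem_sup_left hxR
    · obtain ⟨c, hc⟩ := hdep w x hwR (Set.pair_comm x w ▸ key x hx hxR w hwQ hwR)
      exact hmem hc (hQN hwQ)
  have hPQ : P ≠ Q := by
    rintro rfl
    exact hvR (hinf ⟨hvP, hvP⟩)
  have hN := finrank_sup_span_singleton hvR
  have h4 := finrank_mono (sup_le hPN hQN)
  have h5 := finrank_sup_add_finrank_inf_eq P Q
  have h6 : P ⊓ Q < P := inf_lt_left.2 fun h => hPQ (eq_of_le_of_finrank_le h (by omega))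
  have h7 := finrank_lt_finrank_of_lt h6
  have lt_of : ∀ {A B : Submodule K V}, A ≤ B → finrank K A < finrank K B → A < B :=
    fun hAB hlt => lt_of_le_of_ne hAB (by rintro rfl; exact hlt.false)
  refine ⟨hPQ, hPR, hQR, _, ⟨P ⊓ Q, R ⊔ span K {v}, by omega, by omega, ?_, rfl⟩,
    ⟨h6, ?_⟩, ⟨?_, ?_⟩, ⟨?_, ?_⟩⟩
  · exact h6.trans_le hPN
  · exact lt_of hPN (by omega)
  · exact lt_of inf_le_right (by omega)
  · exact lt_of hQN (by omega)
  · exact lt_of hinf (by omega)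
  · exact lt_of le_sup_left (by omega)

theorem complAdjacentVia_iff {n : ℕ} (hn : 1 ≤ n) {P Q R : Submodule K V}
    (hP : finrank K P = n) (hQ : finrank K Q = n) (hR : finrank K R = n) :
    ComplAdjacentVia P Q R ↔
      P ≠ Q ∧ P ≠ R ∧ Q ≠ R ∧ ∃ L, IsPencilLine K n L ∧ P ∈ L ∧ Q ∈ L ∧ R ∈ L :=
  ⟨fun h => h.exists_isPencilLine hn hP hQ hR,
    fun ⟨hPQ, hPR, hQR, _, hL, hPL, hQL, hRL⟩ => .of_isPencilLine hn hPQ hPR hQR hL hPL hQL hRL⟩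

theorem collinear_iff_finrank_inf_eq {n : ℕ} (hn : 1 ≤ n) {P Q : Submodule K V}
    (hP : finrank K P = n) (hQ : finrank K Q = n) :
    (P ≠ Q ∧ ∃ L, IsPencilLine K n L ∧ P ∈ L ∧ Q ∈ L) ↔
      finrank K (P ⊓ Q : Submodule K V) = n - 1 := by
  constructor
  · rintro ⟨hPQ, _, ⟨M, N, hM, hN, -, rfl⟩, hPL, hQL⟩
    rw [← inf_eq_of_finrank_eq hM hP hQ hPL.1.le hQL.1.le hPQ, hM]
  · intro h
    have hne : ¬ P ≤ Q := fun hle => by rw [inf_eq_left.2 hle] at h; omega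
    have hne' : ¬ Q ≤ P := fun hle => by rw [inf_eq_right.2 hle] at h; omega
    have := finrank_sup_add_finrank_inf_eq P Q
    have hlt : P ⊓ Q < P := inf_lt_left.2 hne
    have hlt' : P < P ⊔ Q := left_lt_sup.2 hne'
    exact ⟨fun h => hne h.le, _, ⟨P ⊓ Q, P ⊔ Q, h, by omega, hlt.trans hlt', rfl⟩,
      ⟨hlt, hlt'⟩, inf_lt_right.2 hne', right_lt_sup.2 hne⟩

/-- Adjacent subspaces lie on a pencil with a third element. -/
theorem exists_complAdjacentVia_iff {n : ℕ} (hn : 1 ≤ n) {P Q : Submodule K V}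
    (hP : finrank K P = n) (hQ : finrank K Q = n) :
    (∃ R : Submodule K V, finrank K R = n ∧ ComplAdjacentVia P Q R) ↔
      finrank K (P ⊓ Q : Submodule K V) = n - 1 := by
  constructor
  · rintro ⟨R, hR, h⟩
    obtain ⟨hPQ, -, -, L, hL, hPL, hQL, -⟩ := (complAdjacentVia_iff hn hP hQ hR).1 h
    exact (collinear_iff_finrank_inf_eq hn hP hQ).1 ⟨hPQ, L, hL, hPL, hQL⟩
  · intro h
    obtain ⟨v, hvP, hvQ⟩ : ∃ v ∈ P, v ∉ Q := SetLike.not_le_iff_exists.1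
      fun hle => by rw [inf_eq_left.2 hle] at h; omega
    obtain ⟨w, hwQ, hwP⟩ : ∃ w ∈ Q, w ∉ P := SetLike.not_le_iff_exists.1
      fun hle => by rw [inf_eq_right.2 hle] at h; omega
    have hvwP : v + w ∉ P := fun hm => hwP ((add_mem_cancel_left hvP).1 hm)
    have hvwQ : v + w ∉ Q := fun hm => hvQ ((add_mem_cancel_right hwQ).1 hm)
    have hvwR : v + w ∈ (P ⊓ Q) ⊔ span K {v + w} := mem_sup_right (mem_span_singleton_self _)
    have hR : finrank K ((P ⊓ Q) ⊔ span K {v + w} : Submodule K V) = n := by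
      rw [finrank_sup_span_singleton fun hm : v + w ∈ P ⊓ Q => hvwP hm.1]; omega
    have hsup := finrank_sup_add_finrank_inf_eq P Q
    have hle : (P ⊓ Q) ⊔ span K {v + w} ≤ P ⊔ Q := by
      refine sup_le inf_le_sup ?_
      rw [span_singleton_le_iff_mem]
      exact add_mem (mem_sup_left hvP) (mem_sup_right hwQ)
    have lt_of : ∀ {A B : Submodule K V}, A ≤ B → finrank K A < finrank K B → A < B :=
      fun hAB hlt => lt_of_le_of_ne hAB (by rintro rfl; exact hlt.false)
    refine ⟨_, hR, (complAdjacentVia_iff hn hP hQ hR).2 ⟨fun h => hvQ (h ▸ hvP),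
      fun h => hvwP (h.symm ▸ hvwR), fun h => hvwQ (h.symm ▸ hvwR), _,
      ⟨P ⊓ Q, P ⊔ Q, h, by omega, lt_of inf_le_sup (by omega), rfl⟩, ⟨?_, ?_⟩, ⟨?_, ?_⟩,
      ⟨?_, ?_⟩⟩⟩
    · exact lt_of inf_le_left (by omega)
    · exact lt_of le_sup_left (by omega)
    · exact lt_of inf_le_right (by omega)
    · exact lt_of le_sup_right (by omega)
    · exact lt_of le_sup_left (by omega)
    · exact lt_of hle (by omega)

end GrassmannSpace

section ProjectiveLine

open Module MulOpposite

variable {K U : Type*} [DivisionRing K] [AddCommGroup U] [Module K U]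

/-- The endomorphism `(u, v) ↦ (u, v) * g` of `U × U` given by a matrix over `EndOp K U`. -/
def endOfMatrix (g : Matrix (Fin 2) (Fin 2) (EndOp K U)) : Module.End K (U × U) :=
  ((unop (g 0 0)).prod (unop (g 0 1))).coprod ((unop (g 1 0)).prod (unop (g 1 1)))

theorem endOfMatrix_apply (g : Matrix (Fin 2) (Fin 2) (EndOp K U)) (u v : U) :
    endOfMatrix g (u, v) = (unop (g 0 0) u + unop (g 1 0) v, unop (g 0 1) u + unop (g 1 1) v) := by
  simp [endOfMatrix]

theorem endOfMatrix_one :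
    endOfMatrix (1 : Matrix (Fin 2) (Fin 2) (EndOp K U)) = 1 := by
  refine LinearMap.ext fun ⟨u, v⟩ => ?_
  simp [endOfMatrix_apply]

theorem endOfMatrix_mul (g h : Matrix (Fin 2) (Fin 2) (EndOp K U)) :
    endOfMatrix (g * h) = endOfMatrix h * endOfMatrix g := by
  refine LinearMap.ext fun ⟨u, v⟩ => ?_
  simp only [Module.End.mul_apply, endOfMatrix_apply, Matrix.mul_apply, Fin.sum_univ_two,
    unop_add, unop_mul, LinearMap.add_apply, map_add, Prod.mk.injEq]
  constructor <;> abel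

theorem endOfMatrix_bijective :
    Function.Bijective (endOfMatrix : Matrix (Fin 2) (Fin 2) (EndOp K U) → _) := by
  constructor
  · intro g h hgh
    have h0 (u : U) := LinearMap.congr_fun hgh (u, 0)
    have h1 (u : U) := LinearMap.congr_fun hgh (0, u)
    simp only [endOfMatrix_apply, map_zero, add_zero, zero_add, Prod.mk.injEq] at h0 h1
    ext i j
    apply unop_injective
    refine LinearMap.ext fun u => ?_
    fin_cases i <;> fin_cases j
    exacts [(h0 u).1, (h0 u).2, (h1 u).1, (h1 u).2]
  · intro G
    refine ⟨!![op (.fst K U U ∘ₗ G ∘ₗ .inl K U U), op (.snd K U U ∘ₗ G ∘ₗ .inl K U U);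
      op (.fst K U U ∘ₗ G ∘ₗ .inr K U U), op (.snd K U U ∘ₗ G ∘ₗ .inr K U U)], ?_⟩
    refine LinearMap.ext fun ⟨u, v⟩ => ?_
    have : G (u, v) = G (u, 0) + G (0, v) := by rw [← map_add]; simp
    rw [endOfMatrix_apply, this]
    rfl

theorem isUnit_iff_bijective_endOfMatrix (g : Matrix (Fin 2) (Fin 2) (EndOp K U)) :
    IsUnit g ↔ Function.Bijective (endOfMatrix g) := by
  rw [← Module.End.isUnit_iff]
  constructor
  · rintro ⟨g, rfl⟩
    exact ⟨⟨endOfMatrix g.val, endOfMatrix g⁻¹.val, by rw [← endOfMatrix_mul, g.inv_mul,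
      endOfMatrix_one], by rw [← endOfMatrix_mul, g.mul_inv, endOfMatrix_one]⟩, rfl⟩
  · rintro ⟨G, hG⟩
    obtain ⟨h, hh⟩ := endOfMatrix_bijective.2 G⁻¹.val
    exact ⟨⟨g, h, endOfMatrix_bijective.1 (by rw [endOfMatrix_mul, endOfMatrix_one, hh, ← hG,
      G.inv_mul]), endOfMatrix_bijective.1 (by rw [endOfMatrix_mul, endOfMatrix_one, hh, ← hG,
      G.mul_inv])⟩, rfl⟩

theorem isCompl_range_iff_bijective_coprod {R A B C : Type*} [Ring R] [AddCommGroup A]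
    [AddCommGroup B] [AddCommGroup C] [Module R A] [Module R B] [Module R C]
    {f : A →ₗ[R] C} {g : B →ₗ[R] C} (hf : Function.Injective f) (hg : Function.Injective g) :
    IsCompl (LinearMap.range f) (LinearMap.range g) ↔ Function.Bijective (f.coprod g) := by
  rw [isCompl_iff, codisjoint_iff, ← LinearMap.range_coprod, LinearMap.range_eq_top]
  refine and_congr_left fun _ => ⟨fun hd => ?_, fun hinj => ?_⟩
  · rw [← LinearMap.ker_eq_bot, LinearMap.ker_coprod_of_disjoint_range _ _ hd,
      LinearMap.ker_eq_bot.2 hf, LinearMap.ker_eq_bot.2 hg, Submodule.prod_bot]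
  · rw [Submodule.disjoint_def]
    rintro _ ⟨a, rfl⟩ ⟨b, hb⟩
    have : f.coprod g (a, 0) = f.coprod g (0, b) := by simp [hb]
    have := congrArg Prod.fst (hinj this)
    simp only at this
    rw [this, map_zero]

theorem injective_prod_of_units (g : (Matrix (Fin 2) (Fin 2) (EndOp K U))ˣ) :
    Function.Injective ((unop (g.val 0 0)).prod (unop (g.val 0 1))) := by
  intro u v h
  have := ((isUnit_iff_bijective_endOfMatrix g.val).1 g.isUnit).1 (a₁ := (u, 0)) (a₂ := (v, 0))
    (by simpa [endOfMatrix_apply] using h)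
  exact congrArg Prod.fst this

theorem Distant.isPoint_left {R : Type*} [Ring R] {p q : Submodule R (R × R)}
    (h : Distant p q) : IsPoint R p :=
  let ⟨g, hp, _⟩ := h
  ⟨g, hp⟩

theorem distant_iff_isCompl
    {Ψ : Submodule (EndOp K U) (EndOp K U × EndOp K U) → Submodule K (U × U)}
    (hΨ : ∀ a b : Module.End K U,
      IsPoint (EndOp K U) (Submodule.span (EndOp K U) {(op a, op b)}) →
      Ψ (Submodule.span (EndOp K U) {(op a, op b)}) = LinearMap.range (a.prod b))
    {p q : Submodule (EndOp K U) (EndOp K U × EndOp K U)}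
    (hp : IsPoint _ p) (hq : IsPoint _ q) : Distant p q ↔ IsCompl (Ψ p) (Ψ q) := by
  constructor
  · rintro ⟨g, rfl, rfl⟩
    have hbij := (isUnit_iff_bijective_endOfMatrix g.val).1 g.isUnit
    have h1 := hΨ (unop (g.val 0 0)) (unop (g.val 0 1)) hp
    have h2 := hΨ (unop (g.val 1 0)) (unop (g.val 1 1)) hq
    rw [op_unop, op_unop] at h1 h2
    rw [h1, h2, isCompl_range_iff_bijective_coprod (injective_prod_of_units g)]
    · exact hbij
    · intro u v h
      exact congrArg Prod.snd (hbij.1 (a₁ := (0, u)) (a₂ := (0, v))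
        (by simpa [endOfMatrix_apply] using h))
  · intro h
    obtain ⟨g, rfl⟩ := id hp
    obtain ⟨k, rfl⟩ := id hq
    have h1 := hΨ (unop (g.val 0 0)) (unop (g.val 0 1)) hp
    have h2 := hΨ (unop (k.val 0 0)) (unop (k.val 0 1)) hq
    rw [op_unop, op_unop] at h1 h2
    rw [h1, h2, isCompl_range_iff_bijective_coprod (injective_prod_of_units g)
      (injective_prod_of_units k)] at h
    obtain ⟨m, hm⟩ := (isUnit_iff_bijective_endOfMatrix
      !![g.val 0 0, g.val 0 1; k.val 0 0, k.val 0 1]).2 h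
    exact ⟨m, by simp [hm], by simp [hm]⟩

theorem adjacentVia_iff_complAdjacentVia [FiniteDimensional K U]
    {Ψ : Submodule (EndOp K U) (EndOp K U × EndOp K U) → Submodule K (U × U)}
    (hΨ : ∀ a b : Module.End K U,
      IsPoint (EndOp K U) (Submodule.span (EndOp K U) {(op a, op b)}) →
      Ψ (Submodule.span (EndOp K U) {(op a, op b)}) = LinearMap.range (a.prod b))
    (hΨbij : Set.BijOn Ψ {p | IsPoint (EndOp K U) p}
      {W : Submodule K (U × U) | finrank K W = finrank K U})
    {p q r : Submodule (EndOp K U) (EndOp K U × EndOp K U)}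
    (hp : IsPoint _ p) (hq : IsPoint _ q) (hr : IsPoint _ r) :
    AdjacentVia p q r ↔ ComplAdjacentVia (Ψ p) (Ψ q) (Ψ r) := by
  have hforall (S : Submodule K (U × U) → Prop) :
      (∀ X, IsCompl X (Ψ r) → S X) ↔ ∀ x, Distant x r → S (Ψ x) := by
    constructor
    · exact fun h x hx => h _ ((distant_iff_isCompl hΨ hx.isPoint_left hr).1 hx)
    · intro h X hX
      have hXfin : finrank K X = finrank K U := by
        have h1 := Submodule.finrank_add_eq_of_isCompl hX
        have h2 : finrank K (Ψ r) = finrank K U := hΨbij.mapsTo hr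
        rw [h2, finrank_prod] at h1
        omega
      obtain ⟨x, hx, rfl⟩ := hΨbij.surjOn hXfin
      exact h x ((distant_iff_isCompl hΨ hx hr).2 hX)
  have hdist {x y : Submodule (EndOp K U) (EndOp K U × EndOp K U)} (hx : Distant x r)
      (hy : IsPoint _ y) : IsCompl (Ψ x) (Ψ y) ↔ Distant x y :=
    (distant_iff_isCompl hΨ hx.isPoint_left hy).symm
  rw [ComplAdjacentVia, hforall, hforall, hforall]
  refine and_congr (not_congr ?_) (and_congr (not_congr ?_) ?_)
  · exact forall₂_congr fun x hx => (hdist hx hp).symm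
  · exact forall₂_congr fun x hx => (hdist hx hq).symm
  · exact forall₂_congr fun x hx => or_congr (hdist hx hp).symm (hdist hx hq).symm

end ProjectiveLine

/-- Let `R = End_K(U)`, `1 ≤ n = dim U < ∞`, let `Ψ : ℙ(R) → 𝒢`,
`R(a,b) ↦ U^{(a,b)} = {(u^a, u^b)}`, be the canonical bijection onto the set `𝒢` of
`n`-dimensional subspaces of `U × U`.  Then for all points `p, q, r` of `ℙ(R)`:
(1) `p ∼ q` iff `Ψ p`, `Ψ q` are adjacent (`dim (Ψ p ∩ Ψ q) = n - 1`), iff `Ψ p`, `Ψ q`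
are distinct collinear points of the Grassmann space;
(2) `p ∼ q` via `r` iff `Ψ p`, `Ψ q`, `Ψ r` are three distinct collinear points. -/
theorem stmt_5 {K U : Type*} [DivisionRing K] [AddCommGroup U] [Module K U]
    [FiniteDimensional K U] (hU : 1 ≤ Module.finrank K U)
    (Ψ : Submodule (EndOp K U) (EndOp K U × EndOp K U) → Submodule K (U × U))
    (hΨ : ∀ a b : Module.End K U,
      IsPoint (EndOp K U)
        (Submodule.span (EndOp K U) {(MulOpposite.op a, MulOpposite.op b)}) →
      Ψ (Submodule.span (EndOp K U) {(MulOpposite.op a, MulOpposite.op b)}) =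
        LinearMap.range (a.prod b))
    (hΨbij : Set.BijOn Ψ {p | IsPoint (EndOp K U) p}
      {W : Submodule K (U × U) | Module.finrank K W = Module.finrank K U})
    (p q r : Submodule (EndOp K U) (EndOp K U × EndOp K U))
    (hp : IsPoint _ p) (hq : IsPoint _ q) (hr : IsPoint _ r) :
    (Adjacent p q ↔ Module.finrank K ↥(Ψ p ⊓ Ψ q) = Module.finrank K U - 1) ∧
    (Adjacent p q ↔ (Ψ p ≠ Ψ q ∧
      ∃ L, IsPencilLine K (Module.finrank K U) L ∧ Ψ p ∈ L ∧ Ψ q ∈ L)) ∧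
    (AdjacentVia p q r ↔ (Ψ p ≠ Ψ q ∧ Ψ p ≠ Ψ r ∧ Ψ q ≠ Ψ r ∧
      ∃ L, IsPencilLine K (Module.finrank K U) L ∧ Ψ p ∈ L ∧ Ψ q ∈ L ∧ Ψ r ∈ L)) := by
  have hfin : ∀ {x}, IsPoint (EndOp K U) x → Module.finrank K (Ψ x) = Module.finrank K U :=
    fun hx => hΨbij.mapsTo hx
  have hadj : Adjacent p q ↔ Module.finrank K ↥(Ψ p ⊓ Ψ q) = Module.finrank K U - 1 := by
    rw [← exists_complAdjacentVia_iff hU (hfin hp) (hfin hq)]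
    constructor
    · rintro ⟨x, hx, h⟩
      exact ⟨Ψ x, hfin hx, (adjacentVia_iff_complAdjacentVia hΨ hΨbij hp hq hx).1 h⟩
    · rintro ⟨R, hR, h⟩
      obtain ⟨x, hx, rfl⟩ := hΨbij.surjOn hR
      exact ⟨x, hx, (adjacentVia_iff_complAdjacentVia hΨ hΨbij hp hq hx).2 h⟩
  refine ⟨hadj, ?_, ?_⟩
  · rw [hadj, collinear_iff_finrank_inf_eq hU (hfin hp) (hfin hq)]
  · rw [adjacentVia_iff_complAdjacentVia hΨ hΨbij hp hq hr,
      complAdjacentVia_iff hU (hfin hp) (hfin hq) (hfin hr)]
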